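/- Let π = (d1, 3^5, 2^{n−6}) where d1 ≥ 5, d1 ≤ n − 1, n ≥ 6 and σ(π) is even. Then π is potentially K6−C5-graphic if and only if π ≠ (5, 3^5, 2) and π ≠ (5, 3^5, 2^2). -/

import Mathlib

/-- The degree of vertex `i` in the simple graph `G`. -/
noncomputable def degCount {n : ℕ} (G : SimpleGraph (Fin n)) (i : Fin n) : ℕ :=
  {j | G.Adj i j}.ncard

/-- The graph `K₆ − C₅`: the complete graph on 6 vertices minus the edges of a
cycle on 5 of its vertices.  Vertex `0` is adjacent to all other vertices, and the
vertices `1,…,5` carry the complement of a 5-cycle (which is again a 5-cycle).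
Its degree sequence is `(5,3,3,3,3,3)`. -/
def K6C5 : SimpleGraph (Fin 6) :=
  SimpleGraph.fromRel (fun a b =>
    a = 0 ∨ b = 0 ∨
      (a, b) ∈ ([(1, 3), (3, 5), (5, 2), (2, 4), (4, 1)] : List (Fin 6 × Fin 6)))

/-- A list of natural numbers is graphic if it is the degree sequence of some
simple graph. -/
def IsGraphic (l : List ℕ) : Prop :=
  ∃ G : SimpleGraph (Fin l.length), ∀ i : Fin l.length, degCount G i = l.get i

/-- A list of natural numbers is potentially `K₆ − C₅`-graphic if it has a
realization containing `K₆ − C₅` as a subgraph. -/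
def PotentiallyK6C5 (l : List ℕ) : Prop :=
  ∃ G : SimpleGraph (Fin l.length),
    (∀ i : Fin l.length, degCount G i = l.get i) ∧
    ∃ f : Fin 6 → Fin l.length, Function.Injective f ∧
      ∀ a b : Fin 6, K6C5.Adj a b → G.Adj (f a) (f b)

theorem length_wheelSequence (n d : ℕ) (hn : 6 ≤ n) :
    (d :: (List.replicate 5 3 ++ List.replicate (n - 6) 2)).length = n := by
  simp
  omega

theorem get_wheelSequence (n d : ℕ)
    (i : Fin (d :: (List.replicate 5 3 ++ List.replicate (n - 6) 2)).length) :
    (d :: (List.replicate 5 3 ++ List.replicate (n - 6) 2)).get i =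
      if i.val = 0 then d else if i.val < 6 then 3 else 2 := by
  simp only [List.get_eq_getElem, List.getElem_cons, List.getElem_append,
    List.getElem_replicate, List.length_replicate]
  grind

instance : DecidableRel K6C5.Adj := fun a b =>
  inferInstanceAs (Decidable (a ≠ b ∧ ((a = 0 ∨ b = 0 ∨
      (a, b) ∈ ([(1, 3), (3, 5), (5, 2), (2, 4), (4, 1)] : List (Fin 6 × Fin 6))) ∨
    (b = 0 ∨ a = 0 ∨
      (b, a) ∈ ([(1, 3), (3, 5), (5, 2), (2, 4), (4, 1)] : List (Fin 6 × Fin 6))))))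

theorem degCount_K6C5 (a : Fin 6) : degCount K6C5 a = if a = 0 then 5 else 3 := by
  rw [degCount, Set.ncard_eq_toFinset_card']
  revert a
  decide

section Embedding

variable {m n : ℕ} {H : SimpleGraph (Fin m)} {G : SimpleGraph (Fin n)} {f : Fin m → Fin n}

theorem degCount_le_of_embedding (hf : Function.Injective f)
    (hadj : ∀ a b, H.Adj a b → G.Adj (f a) (f b)) (a : Fin m) :
    degCount H a ≤ degCount G (f a) := by
  rw [degCount, ← Set.ncard_image_of_injective _ hf]
  refine Set.ncard_le_ncard ?_ (Set.toFinite _)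
  rintro _ ⟨b, hb, rfl⟩
  exact hadj a b hb

theorem degCount_lt_of_embedding (hf : Function.Injective f)
    (hadj : ∀ a b, H.Adj a b → G.Adj (f a) (f b)) (a : Fin m) {w : Fin n}
    (hw : G.Adj (f a) w) (hwf : w ∉ Set.range f) :
    degCount H a < degCount G (f a) := by
  rw [degCount, ← Set.ncard_image_of_injective _ hf]
  refine Set.ncard_lt_ncard ?_ (Set.toFinite _)
  refine ⟨?_, fun h => ?_⟩
  · rintro _ ⟨b, hb, rfl⟩
    exact hadj a b hb
  · obtain ⟨b, -, rfl⟩ := h hw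
    exact hwf ⟨b, rfl⟩

end Embedding

theorem order_eq_six_or_nine_le {n : ℕ} (hn : 6 ≤ n) (G : SimpleGraph (Fin n))
    (hdeg : ∀ i, degCount G i = if i.val = 0 then 5 else if i.val < 6 then 3 else 2)
    (f : Fin 6 → Fin n) (hf : Function.Injective f)
    (hadj : ∀ a b, K6C5.Adj a b → G.Adj (f a) (f b)) : n = 6 ∨ 9 ≤ n := by
  have hle := degCount_le_of_embedding hf hadj
  have hlt (a : Fin 6) : (f a).val < 6 := by
    have := hle a
    rw [degCount_K6C5, hdeg] at this
    split_ifs at this <;> omega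
  have hsurj : Function.Surjective fun a => (⟨f a, hlt a⟩ : Fin 6) :=
    Finite.surjective_of_injective fun a b hab => hf (Fin.ext (by simpa using hab))
  have hzero : (f 0).val = 0 := by
    have := hle 0
    rw [degCount_K6C5, hdeg] at this
    by_contra h
    simp only [h, if_true, if_false] at this
    split_ifs at this <;> omega
  have hdegeq (a : Fin 6) : degCount G (f a) = degCount K6C5 a := by
    rw [degCount_K6C5, hdeg]
    by_cases ha : a = 0
    · simp [ha, hzero]
    · have : (f a).val ≠ 0 := fun h => ha (hf (Fin.ext (h.trans hzero.symm)))
      simp [ha, this, hlt a]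
  by_contra! hcon
  let v : Fin n := ⟨6, by omega⟩
  have hsub : (Fin.val '' {w | G.Adj v w}) ⊆ ({7} : Set ℕ) := by
    rintro _ ⟨w, hw, rfl⟩
    have hw6 : 6 ≤ w.val := by
      by_contra! h
      obtain ⟨a, ha⟩ := hsurj ⟨w, h⟩
      obtain rfl : f a = w := Fin.ext (by simpa using ha)
      refine (degCount_lt_of_embedding hf hadj a hw.symm ?_).ne' (hdegeq a)
      rintro ⟨b, hb⟩
      have := hlt b
      rw [hb] at this
      exact absurd this (by simp [v])
    have hne : w.val ≠ 6 := fun h => hw.ne (Fin.ext h.symm)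
    have := w.isLt
    simp only [Set.mem_singleton_iff]
    omega
  have hcard := Set.ncard_le_ncard hsub
  rw [Set.ncard_image_of_injective _ Fin.val_injective, Set.ncard_singleton] at hcard
  have hv : degCount G v = 2 := by simp [hdeg, v]
  rw [degCount] at hv
  omega

/-- The edges `{a, b}` with `a < b` of a realization of `(d, 3^5, 2^(n - 6))`: a wheel on the
first six vertices, and on the others `(d - 7) / 2` disjoint edges followed by a path, all of whose
ends are joined to the hub `0`. If `d = 5` the path is closed up to a cycle. -/
def wheelEdge (n d a b : ℕ) : Prop :=
  (a = 0 ∧ 1 ≤ b ∧ b + 1 ≤ d) ∨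
  (a = 0 ∧ ((d = 5 ∧ b = 5) ∨ (d ≠ 5 ∧ b + 1 = n))) ∨
  (a = 1 ∧ b = 3) ∨ (a = 3 ∧ b = 5) ∨ (a = 2 ∧ b = 5) ∨ (a = 2 ∧ b = 4) ∨ (a = 1 ∧ b = 4) ∨
  (6 ≤ a ∧ b = a + 1 ∧ (d ≤ a + 1 ∨ a % 2 = 0)) ∨
  (d = 5 ∧ a = 6 ∧ b + 1 = n ∧ 9 ≤ n)

/-- A realization of `(d, 3^5, 2^(n - 6))` on `N = n` vertices. -/
def wheelRealization (N n d : ℕ) : SimpleGraph (Fin N) :=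
  SimpleGraph.fromRel fun a b => wheelEdge n d a.val b.val

theorem degCount_eq_card {n : ℕ} (G : SimpleGraph (Fin n)) (i : Fin n) (s : Finset ℕ)
    (hs : ∀ j ∈ s, j < n) (hG : ∀ j : Fin n, G.Adj i j ↔ j.val ∈ s) : degCount G i = s.card := by
  rw [degCount, ← Set.ncard_image_of_injective _ Fin.val_injective, ← Set.ncard_coe_finset s]
  congr 1
  ext x
  simp only [Set.mem_image, Set.mem_ofPred_eq, hG, Finset.mem_coe]
  exact ⟨by rintro ⟨j, hj, rfl⟩; exact hj, fun hx => ⟨⟨x, hs x hx⟩, hx, rfl⟩⟩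

theorem wheelRealization_adj {N n d : ℕ} (i j : Fin N) :
    (wheelRealization N n d).Adj i j ↔
      i.val ≠ j.val ∧ (wheelEdge n d i.val j.val ∨ wheelEdge n d j.val i.val) := by
  simp [wheelRealization, SimpleGraph.fromRel_adj, Fin.ext_iff]

theorem degCount_wheelRealization_hub {N n d : ℕ} (hN : N = n) (hd : 5 ≤ d) (hdn : d + 1 ≤ n)
    (i : Fin N) (hi : i.val = 0) : degCount (wheelRealization N n d) i = d := by
  rw [degCount_eq_card _ i (insert (if d = 5 then 5 else n - 1) (Finset.Icc 1 (d - 1)))]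
  · rw [Finset.card_insert_of_notMem, Nat.card_Icc]
    · omega
    · rw [Finset.mem_Icc]
      split_ifs <;> omega
  · intro j hj
    rw [Finset.mem_insert, Finset.mem_Icc] at hj
    split_ifs at hj <;> omega
  · intro j
    simp [wheelRealization_adj, wheelEdge, hi]
    split_ifs <;> omega

theorem degCount_wheelRealization_rim {N n d : ℕ} (hN : N = n) (hd : 5 ≤ d) (hdn : d + 1 ≤ n)
    (i : Fin N) (hi : 1 ≤ i.val) (hi' : i.val ≤ 5) :
    degCount (wheelRealization N n d) i = 3 := by
  have key (a b : ℕ) (ha : 1 ≤ a) (hab : a < b) (hb : b ≤ 5)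
      (h : ∀ j : ℕ, (i.val ≠ j ∧ (wheelEdge n d i.val j ∨ wheelEdge n d j i.val)) ↔
        j = 0 ∨ j = a ∨ j = b) : degCount (wheelRealization N n d) i = 3 := by
    rw [degCount_eq_card _ i {0, a, b}]
    · exact Finset.card_eq_three.2 ⟨0, a, b, by omega, by omega, by omega, rfl⟩
    · intro j hj
      simp only [Finset.mem_insert, Finset.mem_singleton] at hj
      omega
    · intro j
      simp only [wheelRealization_adj, Finset.mem_insert, Finset.mem_singleton, h]
  have hcases : i.val = 1 ∨ i.val = 2 ∨ i.val = 3 ∨ i.val = 4 ∨ i.val = 5 := by omega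
  rcases hcases with h | h | h | h | h
  · exact key 3 4 (by omega) (by omega) (by omega) fun j => by simp [h, wheelEdge]; omega
  · exact key 4 5 (by omega) (by omega) (by omega) fun j => by simp [h, wheelEdge]; omega
  · exact key 1 5 (by omega) (by omega) (by omega) fun j => by simp [h, wheelEdge]; omega
  · exact key 1 2 (by omega) (by omega) (by omega) fun j => by simp [h, wheelEdge]; omega
  · exact key 2 3 (by omega) (by omega) (by omega) fun j => by simp [h, wheelEdge]; omega

theorem wheelEdge_or_iff_of_six_le {n d i j : ℕ} (hd : 5 ≤ d) (hi : 6 ≤ i) :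
    (wheelEdge n d i j ∨ wheelEdge n d j i) ↔
      (j = i + 1 ∧ (d ≤ i + 1 ∨ i % 2 = 0)) ∨
      (i = j + 1 ∧ 6 ≤ j ∧ (d ≤ j + 1 ∨ j % 2 = 0)) ∨
      (j = 0 ∧ (i + 1 ≤ d ∨ (d ≠ 5 ∧ i + 1 = n))) ∨
      (d = 5 ∧ 9 ≤ n ∧ ((i = 6 ∧ j + 1 = n) ∨ (j = 6 ∧ i + 1 = n))) := by
  have h0 : i ≠ 0 := by omega
  have h1 : i ≠ 1 := by omega
  have h2 : i ≠ 2 := by omega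
  have h3 : i ≠ 3 := by omega
  have h4 : i ≠ 4 := by omega
  have h5 : i ≠ 5 := by omega
  simp only [wheelEdge, h0, h1, h2, h3, h4, h5, hi, false_and, and_false, false_or, true_and]
  constructor <;> intro h <;> omega

theorem degCount_wheelRealization_outer {N n d : ℕ} (hN : N = n) (hd : 5 ≤ d) (hdn : d + 1 ≤ n)
    (hodd : d % 2 = 1) (hn : d = 5 → n = 6 ∨ 9 ≤ n) (i : Fin N) (hi : 6 ≤ i.val) :
    degCount (wheelRealization N n d) i = 2 := by
  have hin := i.isLt
  have key (a b : ℕ) (hab : a ≠ b) (ha : a < n) (hb : b < n)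
      (h : ∀ j : ℕ, j < n →
        ((i.val ≠ j ∧ (wheelEdge n d i.val j ∨ wheelEdge n d j i.val)) ↔ j = a ∨ j = b)) :
      degCount (wheelRealization N n d) i = 2 := by
    rw [degCount_eq_card _ i {a, b}]
    · exact Finset.card_pair hab
    · intro j hj
      simp only [Finset.mem_insert, Finset.mem_singleton] at hj
      omega
    · intro j
      simp only [wheelRealization_adj, Finset.mem_insert, Finset.mem_singleton]
      exact h j (hN ▸ j.isLt)
  simp only [wheelEdge_or_iff_of_six_le hd hi] at key
  by_cases hd5 : d = 5
  · by_cases h6 : i.val = 6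
    · exact key 7 (n - 1) (by omega) (by omega) (by omega) (by omega)
    by_cases hl : i.val + 1 = n
    · exact key 6 (n - 2) (by omega) (by omega) (by omega) (by omega)
    exact key (i - 1) (i + 1) (by omega) (by omega) (by omega) (by omega)
  by_cases hlast : i.val + 1 = n
  · exact key 0 (n - 2) (by omega) (by omega) (by omega) (by omega)
  by_cases hge : d ≤ i.val
  · exact key (i - 1) (i + 1) (by omega) (by omega) (by omega) (by omega)
  by_cases hev : i.val % 2 = 0
  · exact key 0 (i + 1) (by omega) (by omega) (by omega) (by omega)
  · exact key 0 (i - 1) (by omega) (by omega) (by omega) (by omega)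

theorem wheelEdge_of_K6C5_adj {n d : ℕ} (hd : 5 ≤ d) (a b : Fin 6) (h : K6C5.Adj a b) :
    wheelEdge n d a.val b.val ∨ wheelEdge n d b.val a.val := by
  have hcases : ∀ a b : Fin 6, K6C5.Adj a b →
      (a.val = 0 ∧ 1 ≤ b.val) ∨ (b.val = 0 ∧ 1 ≤ a.val) ∨
      (a.val, b.val) ∈ [(1, 3), (3, 5), (2, 5), (2, 4), (1, 4)] ∨
      (b.val, a.val) ∈ [(1, 3), (3, 5), (2, 5), (2, 4), (1, 4)] := by
    decide
  have h := hcases a b h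
  simp only [List.mem_cons, Prod.mk.injEq, List.not_mem_nil, or_false] at h
  have hub (b : ℕ) (h1 : 1 ≤ b) (h6 : b < 6) : wheelEdge n d 0 b := by
    by_cases hbd : b + 1 ≤ d
    · exact .inl ⟨rfl, h1, hbd⟩
    · exact .inr (.inl ⟨rfl, .inl ⟨by omega, by omega⟩⟩)
  rcases h with ⟨h0, h1⟩ | ⟨h0, h1⟩ | h | h
  · exact .inl (h0 ▸ hub b h1 b.isLt)
  · exact .inr (h0 ▸ hub a h1 a.isLt)
  · exact .inl (by rcases h with h | h | h | h | h <;> simp [wheelEdge, h])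
  · exact .inr (by rcases h with h | h | h | h | h <;> simp [wheelEdge, h])

theorem lemma211_2 (n d1 : ℕ) (hn : 6 ≤ n) (hd1 : 5 ≤ d1) (hd1n : d1 ≤ n - 1)
    (heven : Even ((d1 :: (List.replicate 5 3 ++ List.replicate (n - 6) 2)).sum)) :
    PotentiallyK6C5 (d1 :: (List.replicate 5 3 ++ List.replicate (n - 6) 2)) ↔
      ((d1 :: (List.replicate 5 3 ++ List.replicate (n - 6) 2)) ≠ [5, 3, 3, 3, 3, 3, 2] ∧
       (d1 :: (List.replicate 5 3 ++ List.replicate (n - 6) 2)) ≠ [5, 3, 3, 3, 3, 3, 2, 2]) := by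
  have hlen := length_wheelSequence n d1 hn
  have hodd : d1 % 2 = 1 := by
    simp only [List.sum_cons, List.sum_append, List.sum_replicate, smul_eq_mul] at heven
    rw [Nat.even_iff] at heven
    omega
  constructor
  · rintro ⟨G, hG, f, hf, hadj⟩
    have h (h5 : d1 = 5) : n = 6 ∨ 9 ≤ n := by
      rw [← hlen]
      refine order_eq_six_or_nine_le (hlen.symm ▸ hn) G (fun i => ?_) f hf hadj
      rw [hG, get_wheelSequence, h5]
    constructor <;> intro heq
    · have h7 := congrArg List.length heq
      have h5 := h (List.cons.inj heq).1
      rw [hlen] at h7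
      simp only [List.length_cons, List.length_nil] at h7
      omega
    · have h8 := congrArg List.length heq
      have h5 := h (List.cons.inj heq).1
      rw [hlen] at h8
      simp only [List.length_cons, List.length_nil] at h8
      omega
  · rintro ⟨h7, h8⟩
    have h (h5 : d1 = 5) : n = 6 ∨ 9 ≤ n := by
      subst h5
      by_contra! hcon
      have : n = 7 ∨ n = 8 := by omega
      rcases this with rfl | rfl
      · exact h7 rfl
      · exact h8 rfl
    refine ⟨wheelRealization _ n d1, fun i => ?_, fun a => ⟨a.val, by rw [hlen]; omega⟩,
      fun a b hab => Fin.ext (by simpa using hab), fun a b hab => ?_⟩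
    · rw [get_wheelSequence]
      split_ifs with h0 hlt
      · exact degCount_wheelRealization_hub hlen hd1 (by omega) i h0
      · exact degCount_wheelRealization_rim hlen hd1 (by omega) i (by omega) (by omega)
      · exact degCount_wheelRealization_outer hlen hd1 (by omega) hodd h i (by omega)
    · rw [wheelRealization_adj]
      exact ⟨fun hv => hab.ne (Fin.ext hv), wheelEdge_of_K6C5_adj hd1 a b hab⟩
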